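/- Let 𝔄 and 𝔅 be nonzero C*-algebras and Ψ : 𝔄 → 𝔅 a continuous linear map such that for every state φ on 𝔅 the functional φ∘Ψ is a state on 𝔄. Then Ψ is positive (Ψ(a) ≥ 0 whenever a ≥ 0) and ‖Ψ‖ = 1. Moreover, if 𝔄 is unital, then 𝔅 is unital and Ψ(1_𝔄) = 1_𝔅. -/

import Mathlib

open ComplexOrder

namespace StatePres

open Filter Topology Unitization

section
variable {A : Type*} [NonUnitalCStarAlgebra A] [PartialOrder A] [StarOrderedRing A]

lemma map_nonneg_of_pos {φ : A →L[ℂ] ℂ} (hφ : ∀ b : A, 0 ≤ φ (star b * b)) {x : A}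
    (hx : 0 ≤ x) : 0 ≤ φ x := by
  obtain ⟨b, rfl⟩ := CStarAlgebra.nonneg_iff_eq_star_mul_self.mp hx
  exact hφ b

lemma map_star_of_pos {φ : A →L[ℂ] ℂ} (hφ : ∀ b : A, 0 ≤ φ (star b * b)) (x : A) :
    φ (star x) = star (φ x) := by
  let f : A →ₚ[ℂ] ℂ := PositiveLinearMap.mk₀ (φ : A →ₗ[ℂ] ℂ) (fun x hx => map_nonneg_of_pos hφ hx)
  exact map_star f x

/-- Separation: real parts. -/
lemma add_star_nonneg_of_forall {b : A}
    (hb : ∀ φ : A →L[ℂ] ℂ, (∀ b : A, 0 ≤ φ (star b * b)) → 0 ≤ (φ b).re) :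
    0 ≤ b + star b := by
  by_contra hcon
  have hcl : IsClosed {x : A | 0 ≤ x + star x} :=
    CStarAlgebra.isClosed_nonneg.preimage (continuous_id.add continuous_star)
  have hconv : Convex ℝ {x : A | 0 ≤ x + star x} := by
    intro x hx y hy s t hs ht _
    simp only [Set.mem_ofPred_eq] at *
    have := add_nonneg (smul_nonneg hs hx) (smul_nonneg ht hy)
    convert this using 1
    simp only [star_add, star_smul, star_trivial, smul_add]
    abel
  obtain ⟨f, u, hfu, hf⟩ := RCLike.geometric_hahn_banach_point_closed (𝕜 := ℂ) hconv hcl hcon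
  simp only [Set.mem_ofPred_eq, RCLike.re_eq_complex_re] at hf hfu
  have hu : u < 0 := by simpa using hf 0 (by simp)
  have hpos : ∀ x : A, 0 ≤ x + star x → 0 ≤ (f x).re := by
    intro x hx
    by_contra! hneg
    have ht : 0 < u / (f x).re := div_pos_of_neg_of_neg hu hneg
    have h1 := hf ((u / (f x).re) • x) (by
      have := smul_nonneg ht.le hx
      simpa [star_smul, smul_add] using this)
    rw [← Complex.coe_smul, map_smul] at h1
    simp [hneg.ne] at h1
  have hfpos : ∀ c : A, 0 ≤ f (star c * c) := by
    intro c
    have h0 : 0 ≤ star c * c := star_mul_self_nonneg c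
    have h1 := hpos (star c * c) (by simpa using add_nonneg h0 h0)
    have h2 := hpos (Complex.I • (star c * c)) (by simp)
    have h3 := hpos (-(Complex.I • (star c * c))) (by simp)
    rw [map_neg] at h3
    rw [map_smul] at h2 h3
    simp at h2 h3
    rw [Complex.nonneg_iff]
    exact ⟨h1, by linarith⟩
  have := hb f hfpos
  linarith

lemma nonneg_of_forall {b : A}
    (hb : ∀ φ : A →L[ℂ] ℂ, (∀ b : A, 0 ≤ φ (star b * b)) → 0 ≤ φ b) :
    0 ≤ b := by
  have h1 : 0 ≤ b + star b :=
    add_star_nonneg_of_forall fun φ hφ => (Complex.nonneg_iff.mp (hb φ hφ)).1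
  have h2 : 0 ≤ Complex.I • b + star (Complex.I • b) :=
    add_star_nonneg_of_forall fun φ hφ => by
      simp [← (Complex.nonneg_iff.mp (hb φ hφ)).2]
  have h3 : 0 ≤ (-Complex.I) • b + star ((-Complex.I) • b) :=
    add_star_nonneg_of_forall fun φ hφ => by
      simp [← (Complex.nonneg_iff.mp (hb φ hφ)).2]
  have h4 : Complex.I • (b - star b) = 0 := by
    apply le_antisymm
    · rw [← neg_nonneg]
      convert h3 using 1
      simp [smul_sub]
      abel
    · convert h2 using 1
      simp [smul_sub]
      abel
  have h5 : star b = b := by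
    rw [smul_eq_zero] at h4
    exact (sub_eq_zero.mp (h4.resolve_left Complex.I_ne_zero)).symm
  rw [h5] at h1
  have h6 := smul_nonneg (show (0:ℝ) ≤ 1/2 by norm_num) h1
  rwa [← two_smul ℝ b, smul_smul, show (1/2*2:ℝ) = 1 by norm_num, one_smul] at h6

lemma exists_pos_ne_zero [Nontrivial A] :
    ∃ φ : A →L[ℂ] ℂ, (∀ b : A, 0 ≤ φ (star b * b)) ∧ φ ≠ 0 := by
  by_contra! hcon
  obtain ⟨b, hb⟩ := exists_ne (0 : A)
  apply hb
  apply le_antisymm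
  · rw [← neg_nonneg]
    exact nonneg_of_forall fun φ hφ => by simp [hcon φ hφ]
  · exact nonneg_of_forall fun φ hφ => by simp [hcon φ hφ]

/-- If `e` is a unit, a positive functional attains its norm at `e`. -/
lemma norm_le_of_unit {e : A} (he : ∀ a : A, e * a = a ∧ a * e = a)
    {φ : A →L[ℂ] ℂ} (hφ : ∀ b : A, 0 ≤ φ (star b * b)) : ‖φ‖ ≤ (φ e).re := by
  have hse : star e = e := by
    have h1 := (he (star e)).1
    have h2 := congrArg star h1
    simp only [star_mul, star_star] at h2
    rw [h1] at h2
    exact h2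
  have hee : 0 ≤ φ e := by
    have := hφ e
    rwa [hse, (he e).1] at this
  have hee' := (Complex.nonneg_iff.mp hee).1
  have key : ∀ x : A, IsSelfAdjoint x → (φ x).re ≤ ‖x‖ * (φ e).re := by
    intro x hx
    have h1 : 0 ≤ algebraMap ℝ (Unitization ℂ A) ‖x‖ - (x : Unitization ℂ A) := by
      have := IsSelfAdjoint.le_algebraMap_norm_self (a := (x : Unitization ℂ A)) (hx.inr ℂ)
      rw [Unitization.norm_inr] at this
      exact sub_nonneg.mpr this
    have h2 := star_left_conjugate_nonneg h1 (e : Unitization ℂ A)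
    have h3 : star (e : Unitization ℂ A) * (algebraMap ℝ (Unitization ℂ A) ‖x‖ - (x : Unitization ℂ A)) * e
        = ((‖x‖ • e - x : A) : Unitization ℂ A) := by
      rw [← Unitization.inr_star, hse, mul_sub, sub_mul, ← Unitization.inr_mul, ← Unitization.inr_mul,
        (he x).1, (he x).2, Algebra.algebraMap_eq_smul_one, mul_smul_comm, mul_one, smul_mul_assoc,
        ← Unitization.inr_mul, (he e).1, Unitization.inr_sub, Unitization.inr_smul]
    rw [h3, Unitization.inr_nonneg_iff] at h2
    have h4 := (Complex.nonneg_iff.mp (map_nonneg_of_pos hφ h2)).1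
    rw [map_sub, ← Complex.coe_smul, map_smul] at h4
    simp at h4
    linarith
  refine φ.opNorm_le_bound hee' fun a => ?_
  obtain ⟨c, hc, hca⟩ : ∃ c : ℂ, ‖c‖ = 1 ∧ c * φ a = ‖φ a‖ := by
    by_cases h0 : φ a = 0
    · exact ⟨1, by simp, by simp [h0]⟩
    · refine ⟨‖φ a‖ / φ a, ?_, ?_⟩
      · simp [h0]
      · field_simp
  have h1 := key ((1/2 : ℝ) • (c • a + star (c • a))) (by
    apply IsSelfAdjoint.smul (by simp [IsSelfAdjoint])
    exact IsSelfAdjoint.add_star_self _)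
  have h2 : ‖(1/2 : ℝ) • (c • a + star (c • a))‖ ≤ ‖a‖ := by
    rw [norm_smul]
    have := norm_add_le (c • a) (star (c • a))
    rw [norm_star, norm_smul, hc] at this
    rw [Real.norm_of_nonneg (by norm_num)]
    linarith
  replace h1 := h1.trans (mul_le_mul_of_nonneg_right h2 hee')
  rw [← Complex.coe_smul, map_smul, map_add, map_star_of_pos hφ, map_smul, smul_eq_mul, smul_eq_mul, hca] at h1
  simp at h1
  linarith

end

section
variable {A : Type*} [CStarAlgebra A] [PartialOrder A] [StarOrderedRing A]

/-- Strictly accretive elements are invertible. -/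
lemma isUnit_of_accretive {T : A} (hT : 1 ≤ T + star T) : IsUnit T := by
  nontriviality A
  set s : ℝ := ‖T‖ ^ 2 + 1 with hs
  have hs0 : 0 < s := by positivity
  have h1 : star (algebraMap ℝ A s - T) * (algebraMap ℝ A s - T) ≤ algebraMap ℝ A (s ^ 2 - 1) := by
    have h2 : star T * T ≤ algebraMap ℝ A (‖T‖ ^ 2) := CStarAlgebra.star_mul_le_algebraMap_norm_sq
    have h3 := smul_le_smul_of_nonneg_left hT hs0.le
    have h4 : star (algebraMap ℝ A s - T) * (algebraMap ℝ A s - T)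
        = star T * T - s • (T + star T) + algebraMap ℝ A (s ^ 2) := by
      simp only [Algebra.algebraMap_eq_smul_one, star_sub, star_smul, star_trivial, star_one,
        sub_mul, mul_sub, smul_mul_assoc, mul_smul_comm, one_mul, mul_one, smul_add, smul_sub, smul_smul, sq]
      abel
    rw [h4]
    calc _ ≤ algebraMap ℝ A (‖T‖ ^ 2) - s • (1:A) + algebraMap ℝ A (s ^ 2) := by gcongr
      _ = _ := by
        rw [← Algebra.algebraMap_eq_smul_one, ← map_sub, ← map_add]
        congr 1
        rw [hs]; ring
  have hs1 : 0 ≤ s ^ 2 - 1 := by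
    have : 1 ≤ s := by rw [hs]; nlinarith [sq_nonneg ‖T‖]
    nlinarith
  have h5 := (CStarAlgebra.norm_le_iff_le_algebraMap _ hs1 (star_mul_self_nonneg _)).mpr h1
  rw [CStarRing.norm_star_mul_self] at h5
  have h6 : ‖algebraMap ℝ A s - T‖ < s := by nlinarith [norm_nonneg (algebraMap ℝ A s - T)]
  have h7 : IsUnit (1 - s⁻¹ • (algebraMap ℝ A s - T)) := by
    apply isUnit_one_sub_of_norm_lt_one
    rw [norm_smul, norm_inv, Real.norm_of_nonneg hs0.le]
    rwa [inv_mul_lt_one₀ hs0]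
  have h8 : 1 - s⁻¹ • (algebraMap ℝ A s - T) = s⁻¹ • T := by
    rw [smul_sub, Algebra.algebraMap_eq_smul_one, smul_smul, inv_mul_cancel₀ hs0.ne', one_smul]
    abel
  rw [h8] at h7
  have := h7.smul (Units.mk0 s hs0.ne')
  simpa [Units.smul_def, smul_smul, hs0.ne'] using this

lemma cayley_norm_le {P : A} (hP : 0 ≤ 1 + P + star P) :
    IsUnit (1 + P) ∧ ‖P * Ring.inverse (1 + P)‖ ≤ 1 := by
  have hu : IsUnit (1 + P) := by
    apply isUnit_of_accretive
    rw [← sub_nonneg]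
    convert hP using 1
    simp
    abel
  refine ⟨hu, ?_⟩
  set v := Ring.inverse (1 + P) with hv
  have h1 : (1 + P) * v = 1 := Ring.mul_inverse_cancel _ hu
  have h2 := star_left_conjugate_nonneg hP v
  have h3 : star v * (1 + P + star P) * v = 1 - star (P * v) * (P * v) := by
    have : star v * (1 + P + star P) * v
      = star ((1 + P) * v) * ((1 + P) * v) - star (P * v) * (P * v) := by
      simp only [star_mul, star_add, star_one]
      noncomm_ring
    rw [this, h1]; simp
  rw [h3, sub_nonneg] at h2
  have h4 := (CStarAlgebra.norm_le_one_iff_of_nonneg _ (star_mul_self_nonneg (P * v))).mpr h2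
  rw [CStarRing.norm_star_mul_self] at h4
  nlinarith [norm_nonneg (P * v)]

/-- Real part of the resolvent-type element. -/
lemma re_resolvent_nonneg {w : A} (hw : ‖w‖ < 1) :
    0 ≤ 1 + w * Ring.inverse (1 - w) + star (w * Ring.inverse (1 - w)) := by
  have hu : IsUnit (1 - w) := isUnit_one_sub_of_norm_lt_one hw
  set v := Ring.inverse (1 - w) with hv
  have h1 : (1 - w) * v = 1 := Ring.mul_inverse_cancel _ hu
  have h1' : w * v = v - 1 := by
    rw [← h1]; noncomm_ring
  have h2 : 0 ≤ 1 - star w * w := by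
    rw [sub_nonneg, ← CStarAlgebra.norm_le_one_iff_of_nonneg _ (star_mul_self_nonneg w),
      CStarRing.norm_star_mul_self]
    nlinarith [norm_nonneg w]
  have h3 := star_left_conjugate_nonneg h2 v
  convert h3 using 1
  have : star v * (1 - star w * w) * v = star v * v - star (w * v) * (w * v) := by
    simp only [star_mul]; noncomm_ring
  rw [this, h1']
  simp only [star_sub, star_one]
  noncomm_ring

end

section
variable {A B : Type*} [NonUnitalCStarAlgebra A] [PartialOrder A] [StarOrderedRing A]
  [NonUnitalCStarAlgebra B] [PartialOrder B] [StarOrderedRing B]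

/-- The inclusion into the unitization as a continuous linear map. -/
noncomputable def inrL (B : Type*) [NonUnitalCStarAlgebra B] : B →L[ℂ] Unitization ℂ B :=
  ⟨Unitization.inrHom ℂ ℂ B, Unitization.continuous_inr⟩

lemma inrL_apply (b : B) : inrL B b = (b : Unitization ℂ B) := rfl

lemma norm_inrL_le : ‖inrL B‖ ≤ 1 :=
  ContinuousLinearMap.opNorm_le_bound _ zero_le_one fun b => by
    rw [inrL_apply, Unitization.norm_inr, one_mul]

/-- The second projection as a continuous linear map. -/
noncomputable def sndL (B : Type*) [NonUnitalCStarAlgebra B] : Unitization ℂ B →L[ℂ] B :=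
  ⟨Unitization.sndHom ℂ ℂ B, by
    have h := (Unitization.uniformEquivProd (𝕜 := ℂ) (A := B)).continuous
    exact continuous_snd.comp h⟩

lemma sndL_apply (b : Unitization ℂ B) : sndL B b = b.snd := rfl

lemma state_scale {Ψ : A →L[ℂ] B}
    (h : ∀ φ : B →L[ℂ] ℂ, (∀ b : B, 0 ≤ φ (star b * b)) → ‖φ‖ = 1 →
      (∀ a : A, 0 ≤ φ.comp Ψ (star a * a)) ∧ ‖φ.comp Ψ‖ = 1)
    (φ : B →L[ℂ] ℂ) (hφ : ∀ b : B, 0 ≤ φ (star b * b)) :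
    (∀ a : A, 0 ≤ φ.comp Ψ (star a * a)) ∧ ‖φ.comp Ψ‖ = ‖φ‖ := by
  by_cases h0 : φ = 0
  · subst h0; simp
  have hn : 0 < ‖φ‖ := norm_pos_iff.mpr h0
  have hn' : (0 : ℂ) ≤ ((‖φ‖⁻¹ : ℝ) : ℂ) := by
    rw [Complex.zero_le_real]; positivity
  have hn'' : (0 : ℂ) ≤ ((‖φ‖ : ℝ) : ℂ) := by
    rw [Complex.zero_le_real]; positivity
  obtain ⟨h1, h2⟩ := h (((‖φ‖⁻¹ : ℝ) : ℂ) • φ) (fun b => by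
    rw [ContinuousLinearMap.smul_apply, smul_eq_mul]; exact mul_nonneg hn' (hφ b))
    (by rw [norm_smul, Complex.norm_real, norm_inv, norm_norm, inv_mul_cancel₀ hn.ne'])
  constructor
  · intro a
    have := mul_nonneg hn'' (h1 a)
    rw [ContinuousLinearMap.comp_apply, ContinuousLinearMap.smul_apply, smul_eq_mul, ← mul_assoc,
      ← Complex.ofReal_mul, mul_inv_cancel₀ hn.ne', Complex.ofReal_one, one_mul] at this
    exact this
  · rw [ContinuousLinearMap.smul_comp, norm_smul, Complex.norm_real, norm_inv, norm_norm] at h2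
    field_simp at h2
    exact h2

/-- Positivity passes to the unitizations. -/
lemma unitized_positive {Ψ : A →L[ℂ] B}
    (h : ∀ φ : B →L[ℂ] ℂ, (∀ b : B, 0 ≤ φ (star b * b)) →
      (∀ a : A, 0 ≤ φ.comp Ψ (star a * a)) ∧ ‖φ.comp Ψ‖ = ‖φ‖)
    {y : A} (hy : 0 ≤ 1 + (y : Unitization ℂ A) + star (y : Unitization ℂ A)) :
    0 ≤ 1 + (Ψ y : Unitization ℂ B) + star (Ψ y : Unitization ℂ B) := by
  have key : 0 ≤ ((1/2 : ℝ) • (1 : Unitization ℂ B) + (Ψ y : Unitization ℂ B))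
      + star ((1/2 : ℝ) • (1 : Unitization ℂ B) + (Ψ y : Unitization ℂ B)) := by
    apply add_star_nonneg_of_forall
    intro τ hτ
    have hτ1 : ‖τ‖ ≤ (τ 1).re := norm_le_of_unit (fun a => by simp) hτ
    obtain ⟨hσ, hσn⟩ := h (τ.comp (inrL B)) (fun b => by
      rw [ContinuousLinearMap.comp_apply, inrL_apply, Unitization.inr_mul, Unitization.inr_star]
      exact hτ _)
    set σ := (τ.comp (inrL B)).comp Ψ with hσdef
    have hσle : ‖σ‖ ≤ (τ 1).re := by
      rw [hσn]
      refine (ContinuousLinearMap.opNorm_comp_le _ _).trans (le_trans ?_ hτ1)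
      exact mul_le_of_le_one_right (norm_nonneg _) norm_inrL_le
    have hl := CStarAlgebra.increasingApproximateUnit A
    have hne := hl.neBot
    have hev : ∀ᶠ u in CStarAlgebra.approximateUnit A, 0 ≤ ‖σ‖ + 2 * (σ (u * y * u)).re := by
      filter_upwards [hl.eventually_nonneg, hl.eventually_norm] with u hu0 hu1
      have hus : star u = u := (IsSelfAdjoint.of_nonneg hu0).star_eq
      have h1 := star_left_conjugate_nonneg hy (u : Unitization ℂ A)
      have h2 : star (u : Unitization ℂ A) * (1 + (y : Unitization ℂ A) + star (y : Unitization ℂ A)) * u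
          = ((u * u + u * y * u + star (u * y * u) : A) : Unitization ℂ A) := by
        simp only [star_mul, hus, ← Unitization.inr_star, Unitization.inr_add, Unitization.inr_mul]
        noncomm_ring
      rw [h2, Unitization.inr_nonneg_iff] at h1
      have h3 := (Complex.nonneg_iff.mp (map_nonneg_of_pos hσ h1)).1
      rw [map_add, map_add, map_star_of_pos hσ] at h3
      simp only [Complex.add_re, Complex.star_def, Complex.conj_re] at h3
      have h4 : (σ (u * u)).re ≤ ‖σ‖ := by
        refine (Complex.re_le_norm _).trans ((σ.le_opNorm _).trans ?_)
        refine mul_le_of_le_one_right (norm_nonneg _) ((norm_mul_le _ _).trans ?_)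
        exact mul_le_one₀ hu1 (norm_nonneg _) hu1
      linarith
    have htend : Tendsto (fun u => ‖σ‖ + 2 * (σ (u * y * u)).re) (CStarAlgebra.approximateUnit A)
        (𝓝 (‖σ‖ + 2 * (σ y).re)) := by
      have h1 : Tendsto (fun u => u * y * u) (CStarAlgebra.approximateUnit A) (𝓝 y) := by
        have ha := hl.tendsto_mul_right y
        have hb := hl.tendsto_mul_left y
        have hc : Tendsto (fun u => (u * y - y) * u) (CStarAlgebra.approximateUnit A) (𝓝 0) := by
          have hd : Tendsto (fun u => ‖u * y - y‖) (CStarAlgebra.approximateUnit A) (𝓝 0) := by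
            have := (ha.sub_const y).norm
            simpa using this
          refine squeeze_zero_norm' ?_ hd
          filter_upwards [hl.eventually_norm] with u hu1
          exact (norm_mul_le _ _).trans (mul_le_of_le_one_right (norm_nonneg _) hu1)
        have := hc.add hb
        simp only [zero_add] at this
        refine this.congr fun u => ?_
        rw [sub_mul]; abel
      have h2 : Continuous fun x => ‖σ‖ + 2 * (σ x).re := by fun_prop
      exact (h2.tendsto y).comp h1
    have hfin := ge_of_tendsto htend hev
    have : (τ ((1/2 : ℝ) • (1 : Unitization ℂ B) + (Ψ y : Unitization ℂ B))).re
        = 1/2 * (τ 1).re + (σ y).re := by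
      rw [map_add, ← Complex.coe_smul, map_smul]
      simp [hσdef, inrL_apply]
    rw [this]
    linarith
  convert key using 1
  simp only [star_add, star_smul, star_one, star_trivial]
  have : (1 : Unitization ℂ B) = (1/2 : ℝ) • (1 : Unitization ℂ B) + (1/2 : ℝ) • (1 : Unitization ℂ B) := by
    rw [← add_smul]; norm_num
  nth_rewrite 1 [this]
  abel

lemma norm_apply_le_one {Ψ : A →L[ℂ] B}
    (h : ∀ φ : B →L[ℂ] ℂ, (∀ b : B, 0 ≤ φ (star b * b)) →
      (∀ a : A, 0 ≤ φ.comp Ψ (star a * a)) ∧ ‖φ.comp Ψ‖ = ‖φ‖)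
    {a : A} (ha : ‖a‖ ≤ 1) : ‖Ψ a‖ ≤ 1 := by
  let Θ : Unitization ℂ A →L[ℂ] Unitization ℂ B := (inrL B).comp (Ψ.comp (sndL A))
  let R : ℂ → Unitization ℂ A := fun z => (a : Unitization ℂ A) * Ring.inverse (1 - z • (a : Unitization ℂ A))
  let H : ℂ → Unitization ℂ B := fun z => Θ (R z) * Ring.inverse (1 + z • Θ (R z))
  have hnorm : ∀ z ∈ Metric.ball (0:ℂ) 1, ‖z • (a : Unitization ℂ A)‖ < 1 := by
    intro z hz
    rw [norm_smul, Unitization.norm_inr]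
    rw [mem_ball_zero_iff] at hz
    nlinarith [norm_nonneg z, norm_nonneg a]
  have hfst : ∀ z, (R z).fst = 0 := by
    intro z
    simp [R]
  have hpos : ∀ z ∈ Metric.ball (0:ℂ) 1, 0 ≤ 1 + z • Θ (R z) + star (z • Θ (R z)) := by
    intro z hz
    have h1 := re_resolvent_nonneg (hnorm z hz)
    have h2 : z • (a : Unitization ℂ A) * Ring.inverse (1 - z • (a : Unitization ℂ A))
        = ((z • (R z).snd : A) : Unitization ℂ A) := by
      rw [smul_mul_assoc, Unitization.inr_smul]
      congr 1
      ext
      · simp [R]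
      · simp [R]
    rw [h2] at h1
    have h3 := unitized_positive h h1
    rw [map_smul, Unitization.inr_smul] at h3
    exact h3
  have hRdiff : ∀ z ∈ Metric.ball (0:ℂ) 1, DifferentiableAt ℂ R z := by
    intro z hz
    have hu := isUnit_one_sub_of_norm_lt_one (hnorm z hz)
    have h1 : DifferentiableAt ℂ (fun z : ℂ => 1 - z • (a : Unitization ℂ A)) z := by fun_prop
    exact (h1.inverse hu).const_mul _
  have hHdiff : ∀ z ∈ Metric.ball (0:ℂ) 1, DifferentiableAt ℂ H z := by
    intro z hz
    have h1 : DifferentiableAt ℂ (fun z => Θ (R z)) z := Θ.differentiableAt.comp z (hRdiff z hz)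
    have h2 : DifferentiableAt ℂ (fun z => 1 + z • Θ (R z)) z :=
      (differentiableAt_id.smul h1).const_add _
    exact h1.mul (h2.inverse (cayley_norm_le (hpos z hz)).1)
  have hG : ∀ z ∈ Metric.ball (0:ℂ) 1, ‖z • H z‖ ≤ ‖z‖ := by
    intro z hz
    refine Complex.norm_le_norm_of_mapsTo_ball (f := fun z => z • H z) (R := 1) ?_ ?_ (by simp)
      (by simpa using hz)
    · intro w hw
      exact (differentiableAt_id.smul (hHdiff w hw)).differentiableWithinAt
    · intro w hw
      rw [mem_closedBall_zero_iff]
      have := (cayley_norm_le (hpos w hw)).2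
      rwa [smul_mul_assoc] at this
  have hH : ∀ᶠ z in 𝓝[≠] (0:ℂ), ‖H z‖ ≤ 1 := by
    filter_upwards [self_mem_nhdsWithin,
      mem_nhdsWithin_of_mem_nhds (Metric.ball_mem_nhds (0:ℂ) one_pos)] with z hz0 hz
    have h1 := hG z hz
    rw [norm_smul] at h1
    have h2 : 0 < ‖z‖ := norm_pos_iff.mpr hz0
    exact le_of_mul_le_mul_left (by linarith) h2
  have hcont : Tendsto (fun z => ‖H z‖) (𝓝[≠] (0:ℂ)) (𝓝 ‖H 0‖) :=
    ((hHdiff 0 (by simp)).continuousAt.norm.tendsto).mono_left nhdsWithin_le_nhds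
  have hfin := le_of_tendsto hcont hH
  have hH0 : H 0 = (Ψ a : Unitization ℂ B) := by
    simp [H, R, Θ, inrL_apply, sndL_apply]
  rwa [hH0, Unitization.norm_inr] at hfin

lemma unit_case {Ψ : A →L[ℂ] B}
    (h : ∀ φ : B →L[ℂ] ℂ, (∀ b : B, 0 ≤ φ (star b * b)) →
      (∀ a : A, 0 ≤ φ.comp Ψ (star a * a)) ∧ ‖φ.comp Ψ‖ = ‖φ‖)
    {e : A} (he : ∀ a : A, e * a = a ∧ a * e = a) (hpos : 0 ≤ Ψ e) (hle : ‖Ψ e‖ ≤ 1) (b : B) :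
    Ψ e * b = b := by
  set p := Ψ e with hp
  have hp1 : 0 ≤ 1 - (p : Unitization ℂ B) := by
    rw [sub_nonneg]
    rw [← Unitization.norm_inr (𝕜 := ℂ)] at hle
    exact (CStarAlgebra.norm_le_one_iff_of_nonneg _ (Unitization.inr_nonneg_iff.mpr hpos)).mp hle
  have hconj : star (b : Unitization ℂ B) * (1 - (p : Unitization ℂ B)) * b
      = ((star b * b - star b * p * b : B) : Unitization ℂ B) := by
    simp only [Unitization.inr_sub, Unitization.inr_mul, Unitization.inr_star]
    noncomm_ring
  have h1 : 0 ≤ star b * b - star b * p * b := by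
    have := star_left_conjugate_nonneg hp1 (b : Unitization ℂ B)
    rwa [hconj, Unitization.inr_nonneg_iff] at this
  have h2 : 0 ≤ -(star b * b - star b * p * b) := by
    apply nonneg_of_forall
    intro φ hφ
    have h0 := map_nonneg_of_pos hφ h1
    let L : B →L[ℂ] B := (ContinuousLinearMap.mul ℂ B (star b)).comp ((ContinuousLinearMap.mul ℂ B).flip b)
    have hL : ∀ x, L x = star b * x * b := fun x => by simp [L, mul_assoc]
    let ψ : B →L[ℂ] ℂ := φ.comp L
    have hψ : ∀ x : B, 0 ≤ ψ (star x * x) := by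
      intro x
      have := hφ (x * b)
      simpa [ψ, hL, mul_assoc] using this
    obtain ⟨hσ, hσn⟩ := h ψ hψ
    have h3 := norm_le_of_unit he hσ
    rw [hσn] at h3
    have hl := CStarAlgebra.increasingApproximateUnit B
    have hne := hl.neBot
    have h4 : Tendsto (fun u => (ψ u).re) (CStarAlgebra.approximateUnit B)
        (𝓝 (φ (star b * b)).re) := by
      have h5 : Continuous fun x => (φ (star b * x)).re := by fun_prop
      have := (h5.tendsto b).comp (hl.tendsto_mul_right b)
      refine this.congr fun u => ?_
      simp [ψ, hL, mul_assoc]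
    have h6 : (φ (star b * b)).re ≤ ‖ψ‖ := by
      refine le_of_tendsto h4 ?_
      filter_upwards [hl.eventually_norm] with u hu
      refine (Complex.re_le_norm _).trans ((ψ.le_opNorm _).trans ?_)
      exact mul_le_of_le_one_right (norm_nonneg _) hu
    have h7 : (φ (star b * b)).re ≤ (φ (star b * p * b)).re := by
      refine h6.trans (h3.trans_eq ?_)
      simp [ψ, hL, hp]
    rw [Complex.nonneg_iff] at h0 ⊢
    rw [map_neg]
    rw [map_sub] at h0 ⊢
    simp only [Complex.sub_re, Complex.sub_im, Complex.neg_re, Complex.neg_im] at h0 ⊢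
    constructor
    · linarith
    · linarith [h0.2]
  have h3 : star b * b - star b * p * b = 0 := le_antisymm (neg_nonneg.mp h2) h1
  obtain ⟨q, hq⟩ := CStarAlgebra.nonneg_iff_eq_star_mul_self.mp hp1
  have h4 : q * (b : Unitization ℂ B) = 0 := by
    rw [← CStarRing.star_mul_self_eq_zero_iff]
    rw [h3, hq, Unitization.inr_zero] at hconj
    rw [← hconj, star_mul]
    noncomm_ring
  have h5 : (1 - (p : Unitization ℂ B)) * b = 0 := by
    rw [hq, mul_assoc, h4, mul_zero]
  rw [sub_mul, one_mul, sub_eq_zero, ← Unitization.inr_mul] at h5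
  exact (Unitization.inr_injective h5).symm

end

end StatePres

/-- **State-preserving maps are positive unital contractions.**
Let `A`, `B` be nonzero C⋆-algebras and `Ψ : A → B` a continuous linear map such that for every
state `φ` on `B` (positive continuous linear functional of norm one) the functional `φ ∘ Ψ` is a
state on `A`.  Then `Ψ` is positive (it maps elements of the form `star c * c` to elements of
that same form) and `‖Ψ‖ = 1`.  Moreover, if `A` has a multiplicative unit `e`, then `Ψ e` is a
multiplicative unit for `B` (i.e. `B` is unital and `Ψ(1) = 1`). -/
theorem state_preserving_map_positive_contraction
    {A B : Type*} [NonUnitalCStarAlgebra A] [NonUnitalCStarAlgebra B]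
    [Nontrivial A] [Nontrivial B]
    (Ψ : A →L[ℂ] B)
    (h : ∀ φ : B →L[ℂ] ℂ, (∀ b : B, 0 ≤ φ (star b * b)) → ‖φ‖ = 1 →
      (∀ a : A, 0 ≤ φ.comp Ψ (star a * a)) ∧ ‖φ.comp Ψ‖ = 1) :
    (∀ a : A, (∃ c : A, a = star c * c) → ∃ d : B, Ψ a = star d * d) ∧
    ‖Ψ‖ = 1 ∧
    (∀ e : A, (∀ a : A, e * a = a ∧ a * e = a) →
      ∀ b : B, Ψ e * b = b ∧ b * Ψ e = b) := by
  letI := CStarAlgebra.spectralOrder A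
  letI := CStarAlgebra.spectralOrder B
  haveI := CStarAlgebra.spectralOrderedRing A
  haveI := CStarAlgebra.spectralOrderedRing B
  have h' := StatePres.state_scale h
  have hposi : ∀ c : A, 0 ≤ Ψ (star c * c) := fun c =>
    StatePres.nonneg_of_forall fun φ hφ => (h' φ hφ).1 c
  have hle : ‖Ψ‖ ≤ 1 :=
    Ψ.opNorm_le_bound zero_le_one fun a => by
      by_cases ha : a = 0
      · simp [ha]
      have hn : 0 < ‖a‖ := norm_pos_iff.mpr ha
      have h1 : ‖Ψ (((‖a‖⁻¹ : ℝ) : ℂ) • a)‖ ≤ 1 := StatePres.norm_apply_le_one h' (by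
        rw [norm_smul, Complex.norm_real, norm_inv, norm_norm, inv_mul_cancel₀ hn.ne'])
      rw [map_smul, norm_smul, Complex.norm_real, norm_inv, norm_norm, inv_mul_le_iff₀ hn] at h1
      linarith
  refine ⟨?_, ?_, ?_⟩
  · rintro a ⟨c, rfl⟩
    exact CStarAlgebra.nonneg_iff_eq_star_mul_self.mp (hposi c)
  · refine le_antisymm hle ?_
    obtain ⟨φ, hφ, hφ0⟩ := StatePres.exists_pos_ne_zero (A := B)
    have h1 := (h' φ hφ).2
    have h2 := φ.opNorm_comp_le Ψ
    rw [h1] at h2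
    have h3 : 0 < ‖φ‖ := norm_pos_iff.mpr hφ0
    nlinarith
  · intro e he
    have hse : star e = e := by
      have h1 := (he (star e)).1
      have h2 := congrArg star h1
      simp only [star_mul, star_star] at h2
      rw [h1] at h2
      exact h2
    have hpe : 0 ≤ Ψ e := by
      have := hposi e
      rwa [hse, (he e).1] at this
    have hne : ‖e‖ ≤ 1 := by
      have := CStarRing.norm_star_mul_self (x := e)
      rw [hse, (he e).1] at this
      nlinarith [norm_nonneg e]
    have hnp : ‖Ψ e‖ ≤ 1 := StatePres.norm_apply_le_one h' hne
    have hleft := StatePres.unit_case h' he hpe hnp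
    intro b
    refine ⟨hleft b, ?_⟩
    have h1 := congrArg star (hleft (star b))
    rwa [star_mul, star_star, (IsSelfAdjoint.of_nonneg hpe).star_eq] at h1
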